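/- arXiv:2605.23807 — 2 statements merged into one kernel-verified Lean document; each statement's English description precedes it below -/
import Mathlib

section
/- Let x_1, …, x_k be unit vectors of EuclideanSpace ℝ (Fin d) (‖x_i‖ = 1 for all i) with s := Σ_{i=1}^k x_i ≠ 0, and let ⟨c⟩ = s/‖s‖ be the ℓ2-normalised centroid. Then the trace of the covariance matrix evaluated at u = ⟨c⟩, namely Σ_{i=1}^k (1 − ⟪x_i, ⟨c⟩⟫²), is at most k − ‖s‖²/k. -/
open scoped BigOperators RealInnerProductSpace

/-- Paper's Theorem 2 (quantitative form): for unit vectors `x 1, …, x k` with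
`s = ∑ i, x i ≠ 0` and normalised centroid `⟨c⟩ = s/‖s‖`, the trace of the covariance
matrix at `⟨c⟩`, namely `∑ i, (1 - ⟪x i, ⟨c⟩⟫²)`, is at most `k - ‖s‖²/k`. -/
theorem trace_covariance_at_normalized_centroid_le
    (d k : ℕ) (x : Fin k → EuclideanSpace ℝ (Fin d))
    (hx : ∀ i, ‖x i‖ = 1)
    (s : EuclideanSpace ℝ (Fin d)) (hs : s = ∑ i, x i) (hs0 : s ≠ 0)
    (c : EuclideanSpace ℝ (Fin d)) (hc : c = ‖s‖⁻¹ • s) :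
    ∑ i, (1 - ⟪x i, c⟫ ^ 2) ≤ (k : ℝ) - ‖s‖ ^ 2 / (k : ℝ) := by
  have hsum : ∑ i, ⟪x i, c⟫ = ‖s‖ := by
    have hn : ‖s‖ ≠ 0 := norm_ne_zero_iff.mpr hs0
    rw [← sum_inner, ← hs, hc, real_inner_smul_right, real_inner_self_eq_norm_sq]
    field_simp
  have hcs : ‖s‖ ^ 2 ≤ k * ∑ i, ⟪x i, c⟫ ^ 2 := by
    simpa [hsum] using
      sq_sum_le_card_mul_sum_sq (s := Finset.univ) (f := fun i => ⟪x i, c⟫)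
  have hdiv : ‖s‖ ^ 2 / (k : ℝ) ≤ ∑ i, ⟪x i, c⟫ ^ 2 :=
    div_le_of_le_mul₀ (Nat.cast_nonneg k) (Finset.sum_nonneg fun i _ => sq_nonneg _)
      (by rwa [mul_comm])
  have htrace : ∑ i, (1 - ⟪x i, c⟫ ^ 2) = (k : ℝ) - ∑ i, ⟪x i, c⟫ ^ 2 := by
    simp [Finset.sum_sub_distrib]
  rw [htrace]
  exact sub_le_sub_left hdiv _
end

section
/- Let x_1, …, x_k be unit vectors of EuclideanSpace ℝ (Fin d) with s := Σ_{i=1}^k x_i ≠ 0, and let ⟨c⟩ = s/‖s‖ be the ℓ2-normalised centroid. Then for every unit vector u ∈ EuclideanSpace ℝ (Fin d), the sum of off-diagonal covariance entries at ⟨c⟩ exceeds that at u by at most Σ_{i=1}^k ⟪x_i, ⟨c⟩⟫²; that is, Σ_{i ≠ j} (⟪x_i, x_j⟫ − ⟪x_i, ⟨c⟩⟫⟪x_j, ⟨c⟩⟫) ≤ Σ_{i ≠ j} (⟪x_i, x_j⟫ − ⟪x_i, u⟫⟪x_j, u⟫) + Σ_{i=1}^k ⟪x_i, ⟨c⟩⟫².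 In other words, the normalised centroid minimises the sum of off-diagonal covariances to within an additive bound of Σ_{i=1}^k ⟪x_i, ⟨c⟩⟫². -/
open scoped BigOperators RealInnerProductSpace

/-- The sum of the products of distinct-index pairs is the square of the sum minus the sum of
the squares. -/
theorem sum_filter_ne_mul {ι R : Type*} [Fintype ι] [DecidableEq ι] [CommRing R] (a : ι → R) :
    ∑ p ∈ Finset.univ.filter (fun p : ι × ι => p.1 ≠ p.2), a p.1 * a p.2
      = (∑ i, a i) ^ 2 - ∑ i, a i ^ 2 := by
  rw [eq_sub_iff_add_eq', Finset.sum_filter, Fintype.sum_prod_type, sq, Finset.sum_mul_sum,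
    ← Finset.sum_add_distrib]
  refine Finset.sum_congr rfl fun i _ => ?_
  rw [← Finset.sum_erase_add _ _ (Finset.mem_univ i),
    ← Finset.sum_erase_add _ (fun j => a i * a j) (Finset.mem_univ i), sq]
  have h : ∑ j ∈ Finset.univ.erase i, (if (i, j).1 ≠ (i, j).2 then a (i, j).1 * a (i, j).2 else 0)
      = ∑ j ∈ Finset.univ.erase i, a i * a j :=
    Finset.sum_congr rfl fun j hj => if_pos (Finset.ne_of_mem_erase hj).symm
  rw [h, if_neg (not_not.mpr rfl), add_zero, add_comm]

/-- Paper's Theorem 3: for unit vectors `x 1, …, x k` with `s = ∑ i, x i ≠ 0` and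
normalised centroid `⟨c⟩ = s/‖s‖`, the sum of off-diagonal covariance entries at `⟨c⟩`
exceeds that at any unit vector `u` by at most `∑ i, ⟪x i, ⟨c⟩⟫²`. -/
theorem normalized_centroid_almost_minimizes_offdiag_covariance
    (d k : ℕ) (x : Fin k → EuclideanSpace ℝ (Fin d))
    (hx : ∀ i, ‖x i‖ = 1)
    (s : EuclideanSpace ℝ (Fin d)) (hs : s = ∑ i, x i) (hs0 : s ≠ 0)
    (c : EuclideanSpace ℝ (Fin d)) (hc : c = ‖s‖⁻¹ • s) :
    ∀ u : EuclideanSpace ℝ (Fin d), ‖u‖ = 1 →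
      ∑ p ∈ Finset.univ.filter (fun p : Fin k × Fin k => p.1 ≠ p.2),
          (⟪x p.1, x p.2⟫ - ⟪x p.1, c⟫ * ⟪x p.2, c⟫)
        ≤ (∑ p ∈ Finset.univ.filter (fun p : Fin k × Fin k => p.1 ≠ p.2),
            (⟪x p.1, x p.2⟫ - ⟪x p.1, u⟫ * ⟪x p.2, u⟫))
          + ∑ i, ⟪x i, c⟫ ^ 2 := by
  intro u hu
  have hsc : ⟪s, c⟫ = ‖s‖ := by
    rw [hc, real_inner_smul_right, real_inner_self_eq_norm_sq, sq,
      inv_mul_cancel_left₀ (norm_ne_zero_iff.mpr hs0)]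
  have hsu : ⟪s, u⟫ ^ 2 ≤ ‖s‖ ^ 2 := by
    rw [sq_le_sq, abs_norm]
    simpa [hu] using abs_real_inner_le_norm s u
  simp only [Finset.sum_sub_distrib]
  rw [sum_filter_ne_mul (fun i => ⟪x i, c⟫), sum_filter_ne_mul (fun i => ⟪x i, u⟫),
    ← sum_inner, ← sum_inner, ← hs, hsc]
  have hnonneg : 0 ≤ ∑ i, ⟪x i, u⟫ ^ 2 := Finset.sum_nonneg fun i _ => sq_nonneg _
  linarith
end
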